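/- Let p₀,…,p₄ ∈ ℝ⁴ be affinely independent (a geometric 4-simplex), with outward unit facet normals N₀,…,N₄. Let Rₐ (a ∈ {0,…,4}) be 4×4 real matrices with RₐᵀRₐ = I₄ and det Rₐ = 1, and let αₐ ∈ {−1, 1} be signs such that Nₐ = αₐ·(Rₐ·e₀) for all a. Fix distinct a, b with complementary indices c < d < e, and define Dₐ and D_b as the 3×3 determinants of the spatial components (components 1,2,3) of Rₐ⁻¹R_c·e₀, Rₐ⁻¹R_d·e₀, Rₐ⁻¹R_e·e₀, respectively R_b⁻¹R_c·e₀, R_b⁻¹R_d·e₀, R_b⁻¹R_e·e₀. Let n̂ ∈ ℝ⁴ be a unit vector with ⟨n̂, e₀⟩ = 0 and let A > 0. Then (1/2)·Σ_{I,J} (Nₐ ∧ N_b)_{IJ} · (A·Rₐ·(e₀ ∧ n̂)·Rₐᵀ)_{IJ} > 0 if and only if −sgn(Dₐ·D_b)·⟨Rₐ⁻¹R_b·e₀, n̂⟩ > 0. (This is the content of Theorem 2.3 of the paper, characterizing the Einstein-Hilbert sector by the proper-orientation inequality.) -/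

import Mathlib

open Matrix

/-- The antisymmetric 4×4 matrix (u ∧ v)_{IJ} = u_I v_J − u_J v_I. -/
def wedge (u v : Fin 4 → ℝ) : Matrix (Fin 4) (Fin 4) ℝ :=
  Matrix.of fun I J => u I * v J - u J * v I

/-- e₀ := (1,0,0,0) ∈ ℝ⁴. -/
def e0 : Fin 4 → ℝ := ![1, 0, 0, 0]

/-- The spatial part (w₁, w₂, w₃) ∈ ℝ³ of w ∈ ℝ⁴. -/
def sp (w : Fin 4 → ℝ) : Fin 3 → ℝ := fun i => w i.succ

/-- N is the outward unit normal to the a-th facet of the 4-simplex with vertices p. -/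
def IsOutwardNormal (p : Fin 5 → Fin 4 → ℝ) (a : Fin 5) (N : Fin 4 → ℝ) : Prop :=
  N ⬝ᵥ N = 1 ∧ (∀ b c : Fin 5, b ≠ a → c ≠ a → N ⬝ᵥ (p b - p c) = 0) ∧
    ∀ b : Fin 5, b ≠ a → N ⬝ᵥ (p a - p b) < 0

/-- Dₐ := det[sp(Rₐ⁻¹R_c·e₀), sp(Rₐ⁻¹R_d·e₀), sp(Rₐ⁻¹R_e·e₀)]. -/
noncomputable def Ddet (R : Fin 5 → Matrix (Fin 4) (Fin 4) ℝ) (a c d e : Fin 5) : ℝ :=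
  (Matrix.of fun i j =>
    ![sp (((R a)⁻¹ * R c).mulVec e0),
      sp (((R a)⁻¹ * R d).mulVec e0),
      sp (((R a)⁻¹ * R e).mulVec e0)] j i).det

lemma det4_e0 (u v w : Fin 4 → ℝ) :
    (Matrix.of ![e0, u, v, w]).det = (Matrix.of fun i j => ![sp u, sp v, sp w] j i).det := by
  rw [Matrix.det_succ_row_zero, Matrix.det_fin_three]
  simp [Fin.sum_univ_succ, e0, sp, Matrix.det_fin_three, Fin.succAbove]
  ring

lemma rows_mul (u v w z : Fin 4 → ℝ) (P : Matrix (Fin 4) (Fin 4) ℝ) :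
    Matrix.of ![u, v, w, z] * P = Matrix.of ![u ᵥ* P, v ᵥ* P, w ᵥ* P, z ᵥ* P] := by
  ext i j
  fin_cases i <;> simp [Matrix.mul_apply, Matrix.vecMul, dotProduct]

lemma Ddet_eq (R : Fin 5 → Matrix (Fin 4) (Fin 4) ℝ)
    (hR : ∀ a, (R a)ᵀ * R a = 1) (hdet : ∀ a, (R a).det = 1) (a c d e : Fin 5) :
    Ddet R a c d e = (Matrix.of ![R a *ᵥ e0, R c *ᵥ e0, R d *ᵥ e0, R e *ᵥ e0]).det := by
  have hinv : (R a)⁻¹ = (R a)ᵀ := Matrix.inv_eq_left_inv (hR a)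
  have h := rows_mul (R a *ᵥ e0) (R c *ᵥ e0) (R d *ᵥ e0) (R e *ᵥ e0) (R a)
  have h2 := congrArg Matrix.det h
  rw [Matrix.det_mul, hdet a, mul_one] at h2
  rw [h2]
  have key : ∀ x, (R x *ᵥ e0) ᵥ* R a = ((R a)⁻¹ * R x) *ᵥ e0 := by
    intro x
    rw [hinv, ← Matrix.mulVec_mulVec, Matrix.mulVec_transpose]
  rw [key, key, key, key, hinv, hR a, Matrix.one_mulVec, det4_e0, Ddet, hinv]

lemma det_rows_smul (s t r q : ℝ) (u v w z : Fin 4 → ℝ) :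
    (Matrix.of ![s • u, t • v, r • w, q • z]).det
      = s * t * r * q * (Matrix.of ![u, v, w, z]).det := by
  have h : Matrix.of ![s • u, t • v, r • w, q • z]
      = Matrix.diagonal ![s, t, r, q] * Matrix.of ![u, v, w, z] := by
    ext i j
    fin_cases i <;> simp [Matrix.diagonal_mul]
  rw [h, Matrix.det_mul, Matrix.det_diagonal]
  simp only [Fin.prod_univ_four]
  rfl

lemma normals_det (p N : Fin 5 → Fin 4 → ℝ) (hN : ∀ a, IsOutwardNormal p a (N a))
    (a b c d e : Fin 5) (hab : a ≠ b) (hac : a ≠ c) (had : a ≠ d) (hae : a ≠ e)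
    (hbc : b ≠ c) (hbd : b ≠ d) (hbe : b ≠ e) (hcd : c ≠ d) (hce : c ≠ e) (hde : d ≠ e) :
    (Matrix.of ![N a, N c, N d, N e]).det * (Matrix.of ![N b, N c, N d, N e]).det < 0 := by
  have hz : ∀ x y z, y ≠ x → z ≠ x → N x ⬝ᵥ (p y - p z) = 0 := fun x => (hN x).2.1
  have hneg : ∀ x y, y ≠ x → N x ⬝ᵥ (p x - p y) < 0 := fun x => (hN x).2.2
  set P : Matrix (Fin 4) (Fin 4) ℝ :=
    (Matrix.of ![p a - p b, p c - p b, p d - p b, p e - p b])ᵀ with hP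
  have hv : ∀ x, N x ᵥ* P = ![N x ⬝ᵥ (p a - p b), N x ⬝ᵥ (p c - p b),
      N x ⬝ᵥ (p d - p b), N x ⬝ᵥ (p e - p b)] := by
    intro x
    ext j
    fin_cases j <;> simp [hP, Matrix.vecMul, dotProduct]
  have ha : N a ᵥ* P = ![N a ⬝ᵥ (p a - p b), 0, 0, 0] := by
    rw [hv, hz a c b, hz a d b, hz a e b] <;> first | assumption | (symm; assumption)
  have hc : N c ᵥ* P = ![0, N c ⬝ᵥ (p c - p b), 0, 0] := by
    rw [hv, hz c a b, hz c d b, hz c e b] <;> first | assumption | (symm; assumption)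
  have hd : N d ᵥ* P = ![0, 0, N d ⬝ᵥ (p d - p b), 0] := by
    rw [hv, hz d a b, hz d c b, hz d e b] <;> first | assumption | (symm; assumption)
  have he : N e ᵥ* P = ![0, 0, 0, N e ⬝ᵥ (p e - p b)] := by
    rw [hv, hz e a b, hz e c b, hz e d b] <;> first | assumption | (symm; assumption)
  have h1 := congrArg Matrix.det (rows_mul (N a) (N c) (N d) (N e) P)
  have h2 := congrArg Matrix.det (rows_mul (N b) (N c) (N d) (N e) P)
  rw [Matrix.det_mul, ha, hc, hd, he] at h1
  rw [Matrix.det_mul, hv b, hc, hd, he] at h2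
  have na := hneg a b hab.symm
  have nc := hneg c b hbc
  have nd := hneg d b hbd
  have ne := hneg e b hbe
  have nb : 0 < N b ⬝ᵥ (p a - p b) := by
    have := hneg b a hab
    rw [← neg_sub, dotProduct_neg] at this
    linarith
  generalize N a ⬝ᵥ (p a - p b) = A at *
  generalize N b ⬝ᵥ (p a - p b) = B at *
  generalize N b ⬝ᵥ (p c - p b) = B1 at *
  generalize N b ⬝ᵥ (p d - p b) = B2 at *
  generalize N b ⬝ᵥ (p e - p b) = B3 at *
  generalize N c ⬝ᵥ (p c - p b) = C at *
  generalize N d ⬝ᵥ (p d - p b) = D at *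
  generalize N e ⬝ᵥ (p e - p b) = E at *
  have e1 : (Matrix.of ![![A, 0, 0, 0], ![0, C, 0, 0], ![0, 0, D, 0], ![0, 0, 0, E]]).det
      = A * (C * (D * E)) := by
    rw [Matrix.det_succ_row_zero]
    simp [Fin.sum_univ_succ, Matrix.det_fin_three, Fin.succAbove]
    try grind
  have e2 : (Matrix.of ![![B, B1, B2, B3], ![0, C, 0, 0], ![0, 0, D, 0], ![0, 0, 0, E]]).det
      = B * (C * (D * E)) := by
    rw [Matrix.det_succ_row_zero]
    simp [Fin.sum_univ_succ, Matrix.det_fin_three, Fin.succAbove]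
    try grind
  rw [e1] at h1
  rw [e2] at h2
  have hX : C * (D * E) < 0 := mul_neg_of_neg_of_pos nc (mul_pos_of_neg_of_neg nd ne)
  have p1 := mul_pos_of_neg_of_neg na hX
  have p2 := mul_neg_of_pos_of_neg nb hX
  rw [← h1] at p1
  rw [← h2] at p2
  have p3 := mul_neg_of_pos_of_neg p1 p2
  by_contra hcon
  push Not at hcon
  nlinarith [mul_nonneg hcon (sq_nonneg P.det)]

lemma wedge_conj (R : Matrix (Fin 4) (Fin 4) ℝ) (u v : Fin 4 → ℝ) :
    R * wedge u v * Rᵀ = wedge (R *ᵥ u) (R *ᵥ v) := by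
  have hw : ∀ x y, wedge x y = Matrix.vecMulVec x y - Matrix.vecMulVec y x := by
    intro x y
    ext i j
    simp [wedge, Matrix.vecMulVec_apply]
    ring
  rw [hw, hw, Matrix.mul_sub, Matrix.sub_mul, Matrix.mul_vecMulVec, Matrix.mul_vecMulVec,
    Matrix.vecMulVec_mul, Matrix.vecMulVec_mul, Matrix.vecMul_transpose, Matrix.vecMul_transpose]

lemma wedge_pair (u v x y : Fin 4 → ℝ) (A : ℝ) :
    (1 / 2) * ∑ I : Fin 4, ∑ J : Fin 4, wedge u v I J * (A • wedge x y) I J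
      = A * ((u ⬝ᵥ x) * (v ⬝ᵥ y) - (u ⬝ᵥ y) * (v ⬝ᵥ x)) := by
  simp [Fin.sum_univ_succ, wedge, dotProduct]
  ring

/-- Theorem 2.3 of the paper: the Einstein-Hilbert sector condition
(1/2)·Σ_{I,J} (Nₐ ∧ N_b)_{IJ}·(A·Rₐ·(e₀ ∧ n̂)·Rₐᵀ)_{IJ} > 0 holds iff the
proper-orientation inequality −sgn(Dₐ·D_b)·⟨Rₐ⁻¹R_b·e₀, n̂⟩ > 0 holds. -/
theorem einstein_hilbert_sector_iff (p : Fin 5 → Fin 4 → ℝ) (hp : AffineIndependent ℝ p)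
    (N : Fin 5 → Fin 4 → ℝ) (hN : ∀ a, IsOutwardNormal p a (N a))
    (R : Fin 5 → Matrix (Fin 4) (Fin 4) ℝ)
    (hR : ∀ a, (R a)ᵀ * R a = 1) (hdet : ∀ a, (R a).det = 1)
    (α : Fin 5 → ℝ) (hα : ∀ a, α a = 1 ∨ α a = -1)
    (hNa : ∀ a, N a = α a • (R a).mulVec e0)
    (a b c d e : Fin 5) (hab : a ≠ b) (hcd : c < d) (hde : d < e)
    (hcompl : ({a, b, c, d, e} : Finset (Fin 5)) = Finset.univ)
    (n : Fin 4 → ℝ) (hn : n ⬝ᵥ n = 1) (hn0 : n ⬝ᵥ e0 = 0)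
    (A : ℝ) (hA : 0 < A) :
    0 < (1 / 2) * ∑ I : Fin 4, ∑ J : Fin 4,
          (wedge (N a) (N b)) I J * (A • (R a * wedge e0 n * (R a)ᵀ)) I J
      ↔ 0 < -Real.sign (Ddet R a c d e * Ddet R b c d e) *
          (((R a)⁻¹ * R b).mulVec e0 ⬝ᵥ n) := by
  have hNdet : (Matrix.of ![N a, N c, N d, N e]).det * (Matrix.of ![N b, N c, N d, N e]).det < 0 := by
    have hsurj : Function.Surjective ![a, b, c, d, e] := by
      intro x
      have hx : x ∈ ({a, b, c, d, e} : Finset (Fin 5)) := by rw [hcompl]; simp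
      simp only [Finset.mem_insert, Finset.mem_singleton] at hx
      rcases hx with h | h | h | h | h
      · exact ⟨0, h.symm⟩
      · exact ⟨1, h.symm⟩
      · exact ⟨2, h.symm⟩
      · exact ⟨3, h.symm⟩
      · exact ⟨4, h.symm⟩
    have hinj := Finite.injective_iff_surjective.mpr hsurj
    have hne : ∀ i j : Fin 5, i ≠ j → ![a, b, c, d, e] i ≠ ![a, b, c, d, e] j :=
      fun i j hij h => hij (hinj h)
    exact normals_det p N hN a b c d e hab (hne 0 2 (by decide)) (hne 0 3 (by decide))
      (hne 0 4 (by decide)) (hne 1 2 (by decide)) (hne 1 3 (by decide)) (hne 1 4 (by decide))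
      (hne 2 3 (by decide)) (hne 2 4 (by decide)) (hne 3 4 (by decide))
  have hdot : ∀ u v, (R a *ᵥ u) ⬝ᵥ (R a *ᵥ v) = u ⬝ᵥ v := by
    intro u v
    rw [Matrix.dotProduct_mulVec, Matrix.vecMul_mulVec, hR a, Matrix.vecMul_one]
  have he0 : e0 ⬝ᵥ e0 = 1 := by simp [e0, dotProduct, Fin.sum_univ_succ]
  have hinv : (R a)⁻¹ = (R a)ᵀ := Matrix.inv_eq_left_inv (hR a)
  have hk : ((R a)⁻¹ * R b) *ᵥ e0 ⬝ᵥ n = (R b *ᵥ e0) ⬝ᵥ (R a *ᵥ n) := by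
    rw [hinv, ← Matrix.mulVec_mulVec, Matrix.mulVec_transpose, Matrix.dotProduct_mulVec]
  rw [wedge_conj, wedge_pair, hk, hNa a, hNa b, smul_dotProduct, smul_dotProduct, smul_dotProduct,
    smul_dotProduct, hdot, hdot, he0, dotProduct_comm e0 n, hn0, Ddet_eq R hR hdet,
    Ddet_eq R hR hdet]
  rw [hNa a, hNa b, hNa c, hNa d, hNa e, det_rows_smul, det_rows_smul] at hNdet
  generalize (Matrix.of ![R a *ᵥ e0, R c *ᵥ e0, R d *ᵥ e0, R e *ᵥ e0]).det = X at *
  generalize (Matrix.of ![R b *ᵥ e0, R c *ᵥ e0, R d *ᵥ e0, R e *ᵥ e0]).det = Y at *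
  generalize (R b *ᵥ e0) ⬝ᵥ (R a *ᵥ n) = t at *
  have sq : ∀ x, α x * α x = 1 := by
    intro x
    rcases hα x with h | h <;> rw [h] <;> norm_num
  have hXY : (α a * α b) * (X * Y) < 0 := by
    have : α a * α c * α d * α e * X * (α b * α c * α d * α e * Y)
        = (α c * α c) * (α d * α d) * (α e * α e) * ((α a * α b) * (X * Y)) := by ring
    rw [this, sq, sq, sq] at hNdet
    linarith
  have hs : α a * α b = 1 ∨ α a * α b = -1 := by
    rcases hα a with h | h <;> rcases hα b with h' | h' <;> rw [h, h'] <;> norm_num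
  have hl : A * (α a • 1 * α b • t - α a • 0 * α b • ((R b *ᵥ e0) ⬝ᵥ (R a *ᵥ e0)))
      = A * ((α a * α b) * t) := by
    simp only [smul_eq_mul]; ring
  have hl' : 0 < A * ((α a * α b) * t) ↔ 0 < (α a * α b) * t := mul_pos_iff_of_pos_left hA
  rcases hs with h | h
  · rw [h, one_mul] at hXY
    rw [Real.sign_of_neg hXY, hl, hl', h]
    norm_num
  · rw [h] at hXY
    rw [Real.sign_of_pos (by linarith), hl, hl', h]
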